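/- Let T be a tree with vertex set V, let a group Γ act on T by graph automorphisms, let s and r be H-segments in T, and let x and w be vertices of T. Then there exists a bounded Γ-invariant function β : Γ⁴ → ℝ such that δβ = (δ¹f̂_{s,x}) ∪ (δ¹f̂_{r,w}) as functions Γ⁵ → ℝ; that is, the cup product [δ¹f̂_{s,x}] ∪ [δ¹f̂_{r,w}] of the two median quasimorphism classes is trivial in degree-4 bounded cohomology of the group Γ. -/

import Mathlib

open scoped BigOperators

namespace MedianQM

variable {V : Type*}

/-- The interval `[x,y]`: vertices on geodesics from `x` to `y`. -/
def interval (X : SimpleGraph V) (x y : V) : Set V :=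
  {m | X.dist x m + X.dist m y = X.dist x y}

/-- A median graph: connected, and any three vertices admit a unique median. -/
def IsMedianGraph (X : SimpleGraph V) : Prop :=
  X.Connected ∧ ∀ x y z : V, ∃! m : V,
    m ∈ interval X x y ∧ m ∈ interval X y z ∧ m ∈ interval X x z

/-- A halfspace of `X`: the set of vertices strictly closer to one endpoint of
an edge than to the other. -/
def IsHalfspace (X : SimpleGraph V) (h : Set V) : Prop :=
  ∃ a b : V, X.Adj a b ∧ h = {v | X.dist v a < X.dist v b}

/-- The edge `{a,b}` is dual to the halfspace `h` (equivalently, to the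
hyperplane `{h, h̄}`). -/
def EdgeDual (X : SimpleGraph V) (h : Set V) (a b : V) : Prop :=
  X.Adj a b ∧
    (h = {v | X.dist v a < X.dist v b} ∨ h = {v | X.dist v b < X.dist v a})

/-- Two halfspaces are transverse. -/
def Transv (h k : Set V) : Prop :=
  (h ∩ k).Nonempty ∧ (hᶜ ∩ k).Nonempty ∧ (h ∩ kᶜ).Nonempty ∧ (hᶜ ∩ kᶜ).Nonempty

/-- `[x,y]_H`: the set of halfspaces separating `y` from `x`. -/
def sepH (X : SimpleGraph V) (x y : V) : Set (Set V) :=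
  {h | IsHalfspace X h ∧ y ∈ h ∧ x ∉ h}

/-- `X` has dimension at most `D`: every (finite) family of pairwise transverse
halfspaces has at most `D` elements. -/
def DimLE (X : SimpleGraph V) (D : ℕ) : Prop :=
  ∀ S : Finset (Set V), (∀ h ∈ S, IsHalfspace X h) →
    (∀ h ∈ S, ∀ k ∈ S, h ≠ k → Transv h k) → S.card ≤ D

/-- `h ⊋ k` are tightly nested: no halfspace lies strictly between them. -/
def TightlyNested (X : SimpleGraph V) (h k : Set V) : Prop :=
  k ⊂ h ∧ ¬ ∃ h' : Set V, IsHalfspace X h' ∧ h' ⊂ h ∧ k ⊂ h'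

/-- A staircase of length `n`. -/
def IsStaircase (X : SimpleGraph V) (n : ℕ) (h k : Fin n → Set V) : Prop :=
  (∀ i, IsHalfspace X (h i)) ∧ (∀ i, IsHalfspace X (k i)) ∧
  (∀ i j : Fin n, i < j → h j ⊂ h i) ∧ (∀ i j : Fin n, i < j → k j ⊂ k i) ∧
  (∀ i, k i ⊂ h i) ∧ (∀ i j : Fin n, j < i → Transv (h i) (k j))

/-- `X` has staircase length at most `σ`: there is no staircase of length `σ+1`. -/
def StaircaseLE (X : SimpleGraph V) (σ : ℕ) : Prop :=
  ∀ h k : Fin (σ + 1) → Set V, ¬ IsStaircase X (σ + 1) h k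

/-- An `H`-segment of length `l`: a tuple of consecutively tightly nested
halfspaces `h₁ ⊋ ⋯ ⊋ h_l`. -/
def IsHSegment (X : SimpleGraph V) (l : ℕ) (s : Fin l → Set V) : Prop :=
  (∀ i, IsHalfspace X (s i)) ∧
  ∀ i j : Fin l, (j : ℕ) = (i : ℕ) + 1 → TightlyNested X (s i) (s j)

/-- The segment `t` is contained in `[x,y]_H`. -/
def SegIn (X : SimpleGraph V) (x y : V) {l : ℕ} (t : Fin l → Set V) : Prop :=
  ∀ i, t i ∈ sepH X x y

/-- The translate of a segment by a group element. -/
def segSMul {Γ : Type*} [SMul Γ V] (γ : Γ) {l : ℕ} (s : Fin l → Set V) :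
    Fin l → Set V :=
  fun i => (γ • ·) '' s i

/-- The set of translates of `s` contained in `[x,y]_H`. -/
def translatesIn (X : SimpleGraph V) (Γ : Type*) [SMul Γ V] {l : ℕ}
    (s : Fin l → Set V) (x y : V) : Set (Fin l → Set V) :=
  {t | (∃ γ : Γ, t = segSMul γ s) ∧ SegIn X x y t}

/-- The median quasimorphism of the segment `s` (for the action of `Γ` on `X`). -/
noncomputable def fs (X : SimpleGraph V) (Γ : Type*) [SMul Γ V] {l : ℕ}
    (s : Fin l → Set V) (x y : V) : ℝ :=
  ((translatesIn X Γ s x y).ncard : ℝ) - ((translatesIn X Γ s y x).ncard : ℝ)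

/-- The coboundary of a function of two variables, evaluated on a triple. -/
noncomputable def d1 (f : V → V → ℝ) (x y z : V) : ℝ := f y z - f x z + f x y

/-- The simplicial coboundary operator. -/
noncomputable def cob {W : Type*} {m : ℕ} (β : (Fin (m + 1) → W) → ℝ) :
    (Fin (m + 2) → W) → ℝ :=
  fun x => ∑ j : Fin (m + 2), (-1 : ℝ) ^ (j : ℕ) * β (fun i => x (j.succAbove i))

/-- Γ-invariance of a cochain. -/
def IsInvariant (Γ : Type*) {W : Type*} [SMul Γ W] {m : ℕ}
    (β : (Fin m → W) → ℝ) : Prop :=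
  ∀ (γ : Γ) (x : Fin m → W), β (fun i => γ • x i) = β x

/-- Boundedness of a real-valued function. -/
def IsBounded {α : Type*} (β : α → ℝ) : Prop := ∃ C : ℝ, ∀ x, |β x| ≤ C

/-- A head of the segment `s`. -/
def IsHead (X : SimpleGraph V) {l : ℕ} (hl : 0 < l) (s : Fin l → Set V)
    (a : V) : Prop :=
  a ∉ s ⟨0, hl⟩ ∧ ∃ b, EdgeDual X (s ⟨0, hl⟩) a b

/-- A tail of the segment `s`. -/
def IsTail (X : SimpleGraph V) {l : ℕ} (hl : 0 < l) (s : Fin l → Set V)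
    (a : V) : Prop :=
  a ∈ s ⟨l - 1, by omega⟩ ∧ ∃ b, EdgeDual X (s ⟨l - 1, by omega⟩) a b

/-- The cochain `κ` is non-transverse to the segment `s`. -/
def NonTransverseTo (X : SimpleGraph V) {n l : ℕ} (hl : 0 < l)
    (κ : (Fin (n + 1) → V) → ℝ) (s : Fin l → Set V) : Prop :=
  (∀ (x : Fin n → V) (a a' : V), IsHead X hl s a → IsHead X hl s a' →
    κ (Fin.cons a x) = κ (Fin.cons a' x)) ∧
  (∀ (x : Fin n → V) (a a' : V), IsTail X hl s a → IsTail X hl s a' →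
    κ (Fin.cons a x) = κ (Fin.cons a' x))

/-- The action of `Γ` on `X` is by graph automorphisms. -/
def ActsOn (Γ : Type*) [SMul Γ V] (X : SimpleGraph V) : Prop :=
  ∀ (γ : Γ) (a b : V), X.Adj a b → X.Adj (γ • a) (γ • b)


/-- The halfspace of vertices strictly closer to `a` than to `b`. -/
abbrev side (T : SimpleGraph V) (a b : V) : Set V := {v | T.dist v a < T.dist v b}

lemma notMem_edges_of_length_eq_dist {T : SimpleGraph V} {a b v : V} (hab : T.Adj a b)
    (hle : T.dist v a ≤ T.dist v b) (p : T.Walk v a) (hp : p.length = T.dist v a) :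
    s(a, b) ∉ p.edges := by
  classical
  intro hmem
  have hb : b ∈ p.support := p.snd_mem_support_of_mem_edges hmem
  have h1 := T.dist_le (p.takeUntil b hb)
  have h2 := p.length_takeUntil_lt_length hb hab.ne'
  omega

lemma edge_mem_of_walk {T : SimpleGraph V} (hT : T.IsTree) {a b : V} (hab : T.Adj a b)
    (p : T.Walk a b) : s(a, b) ∈ p.edges :=
  SimpleGraph.isBridge_iff_forall_walk_mem_edges.1
    (SimpleGraph.isAcyclic_iff_forall_adj_isBridge.1 hT.isAcyclic hab) p

lemma dist_ne_of_adj {T : SimpleGraph V} (hT : T.IsTree) {a b : V} (hab : T.Adj a b) (v : V) :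
    T.dist v a ≠ T.dist v b := by
  intro h
  obtain ⟨p, hp⟩ := hT.connected.exists_walk_length_eq_dist v a
  obtain ⟨q, hq⟩ := hT.connected.exists_walk_length_eq_dist v b
  have h1 := notMem_edges_of_length_eq_dist hab h.le p hp
  have h2 := notMem_edges_of_length_eq_dist hab.symm h.ge q hq
  have h3 := edge_mem_of_walk hT hab (p.reverse.append q)
  rw [Sym2.eq_swap] at h2
  simp [h1, h2] at h3

lemma compl_side {T : SimpleGraph V} (hT : T.IsTree) {a b : V} (hab : T.Adj a b) :
    (side T a b)ᶜ = side T b a := by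
  ext v
  have := dist_ne_of_adj hT hab v
  simp only [Set.mem_compl_iff, Set.mem_ofPred_eq]
  omega

lemma IsHalfspace.compl {T : SimpleGraph V} (hT : T.IsTree) {h : Set V} (hh : IsHalfspace T h) :
    IsHalfspace T hᶜ := by
  obtain ⟨a, b, hab, rfl⟩ := hh
  exact ⟨b, a, hab.symm, compl_side hT hab⟩

lemma left_mem_side {T : SimpleGraph V} {a b : V} (hab : T.Adj a b) : a ∈ side T a b := by
  simp [SimpleGraph.dist_eq_one_iff_adj.2 hab]

lemma right_notMem_side {T : SimpleGraph V} {a b : V} : b ∉ side T a b := by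
  simp

/-- The only edge leaving a halfspace of a tree is the one defining it. -/
lemma eq_of_adj_of_mem_side {T : SimpleGraph V} (hT : T.IsTree) {a b u v : V} (hab : T.Adj a b)
    (huv : T.Adj u v) (hu : u ∈ side T a b) (hv : v ∉ side T a b) : u = a ∧ v = b := by
  have hv' : v ∈ side T b a := by rw [← compl_side hT hab]; exact hv
  obtain ⟨p, hp⟩ := hT.connected.exists_walk_length_eq_dist u a
  obtain ⟨q, hq⟩ := hT.connected.exists_walk_length_eq_dist v b
  have h1 := notMem_edges_of_length_eq_dist hab (le_of_lt hu) p hp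
  have h2 := notMem_edges_of_length_eq_dist hab.symm (le_of_lt hv') q hq
  have h3 := edge_mem_of_walk hT hab (p.reverse.append (.cons huv q))
  rw [Sym2.eq_swap] at h2
  simp only [SimpleGraph.Walk.edges_append, SimpleGraph.Walk.edges_reverse,
    SimpleGraph.Walk.edges_cons, List.mem_append, List.mem_reverse, List.mem_cons, h1, h2,
    or_false, false_or, Sym2.eq_iff] at h3
  rcases h3 with ⟨rfl, rfl⟩ | ⟨rfl, rfl⟩
  · exact ⟨rfl, rfl⟩
  · exact absurd hu right_notMem_side

lemma side_injective {T : SimpleGraph V} (hT : T.IsTree) {a b a' b' : V} (hab : T.Adj a b)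
    (hab' : T.Adj a' b') (h : side T a b = side T a' b') : a = a' ∧ b = b' :=
  eq_of_adj_of_mem_side hT hab' hab (h ▸ left_mem_side hab) (h ▸ right_notMem_side)

lemma exists_walk_in_side {T : SimpleGraph V} (hT : T.IsTree) {a b : V} (hab : T.Adj a b)
    {u v : V} (p : T.Walk u v) (hu : u ∈ side T a b) (hv : v = a) :
    ∃ q : T.Walk u a, ∀ w ∈ q.support, w ∈ side T a b := by
  induction p with
  | nil => subst hv; exact ⟨.nil, by simpa using hu⟩
  | @cons u' v' _ huv _ ih =>
    by_cases hmem : v' ∈ side T a b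
    · obtain ⟨q, hq⟩ := ih hmem hv
      refine ⟨.cons huv q, fun w hw => ?_⟩
      rw [SimpleGraph.Walk.support_cons, List.mem_cons] at hw
      rcases hw with rfl | hw
      · exact hu
      · exact hq w hw
    · obtain ⟨rfl, -⟩ := eq_of_adj_of_mem_side hT hab huv hu hmem
      exact ⟨.nil, by simpa using hu⟩

lemma left_mem_of_separated {T : SimpleGraph V} (hT : T.IsTree) {h : Set V}
    (hh : IsHalfspace T h) {a b y u : V} (hab : T.Adj a b) (hy : y ∈ h) (hu : u ∈ h)
    (hyk : y ∈ side T a b) (huk : u ∉ side T a b) : a ∈ h := by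
  obtain ⟨a', b', hab', rfl⟩ := hh
  obtain ⟨p⟩ := hT.connected y a'
  obtain ⟨q⟩ := hT.connected u a'
  obtain ⟨p, hp⟩ := exists_walk_in_side hT hab' p hy rfl
  obtain ⟨q, hq⟩ := exists_walk_in_side hT hab' q hu rfl
  obtain ⟨d, hd, hd1, hd2⟩ := (p.append q.reverse).exists_boundary_dart _ hyk huk
  obtain ⟨rfl, -⟩ := eq_of_adj_of_mem_side hT hab d.adj hd1 hd2
  have := SimpleGraph.Walk.dart_fst_mem_support_of_mem_darts _ hd
  rw [SimpleGraph.Walk.mem_support_append_iff, SimpleGraph.Walk.support_reverse,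
    List.mem_reverse] at this
  exact this.elim (hp _) (hq _)

/-- In a tree, the halfspaces separating two given vertices form a chain. -/
lemma sepH_total {T : SimpleGraph V} (hT : T.IsTree) {x y : V} {h k : Set V}
    (hh : h ∈ sepH T x y) (hk : k ∈ sepH T x y) : h ⊆ k ∨ k ⊆ h := by
  obtain ⟨hh, hyh, hxh⟩ := hh
  obtain ⟨⟨a, b, hab, rfl⟩, hyk, hxk⟩ := hk
  by_contra! hcon
  obtain ⟨u, huh, huk⟩ := Set.not_subset.1 hcon.1
  obtain ⟨v, hvk, hvh⟩ := Set.not_subset.1 hcon.2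
  exact left_mem_of_separated hT (hh.compl hT) hab hvh hxh hvk hxk
    (left_mem_of_separated hT hh hab hyh huh hyk huk)

lemma sepH_finite {T : SimpleGraph V} (hT : T.IsTree) (x y : V) : (sepH T x y).Finite := by
  obtain ⟨p⟩ := hT.connected y x
  refine (p.darts.finite_toSet.image fun d => side T d.fst d.snd).subset ?_
  rintro _ ⟨⟨a, b, hab, rfl⟩, hy, hx⟩
  obtain ⟨d, hd, hd1, hd2⟩ := p.exists_boundary_dart _ hy hx
  obtain ⟨rfl, rfl⟩ := eq_of_adj_of_mem_side hT hab d.adj hd1 hd2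
  exact ⟨d, hd, rfl⟩

section Segments

variable {T : SimpleGraph V} {l : ℕ} {t t' : Fin l → Set V}

lemma IsHSegment.antitone (ht : IsHSegment T l t) {i j : Fin l} (hij : i ≤ j) : t j ⊆ t i := by
  obtain ⟨j, hj⟩ := j
  induction j with
  | zero =>
    obtain rfl : i = ⟨0, hj⟩ := Fin.ext (by simpa [Fin.le_def] using hij)
    exact subset_rfl
  | succ n ih =>
    rcases hij.eq_or_lt with rfl | hlt
    · exact subset_rfl
    · exact (ht.2 ⟨n, by omega⟩ ⟨n + 1, hj⟩ rfl).1.1.trans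
        (ih (by omega) (by simp only [Fin.lt_def, Fin.le_def] at *; omega))

lemma IsHSegment.exists_consecutive (ht : IsHSegment T l t) {z : V} (hin : ∃ i, z ∈ t i)
    (hout : ∃ i, z ∉ t i) : ∃ i j : Fin l, (j : ℕ) = i + 1 ∧ z ∈ t i ∧ z ∉ t j := by
  obtain ⟨i, hi⟩ := hin
  obtain ⟨⟨j, hj⟩, hzj⟩ := hout
  induction j with
  | zero => exact absurd (ht.antitone (Fin.le_def.2 (Nat.zero_le _)) hi) hzj
  | succ n ih =>
    by_cases hn : z ∈ t ⟨n, by omega⟩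
    · exact ⟨⟨n, by omega⟩, ⟨n + 1, hj⟩, rfl, hn, hzj⟩
    · exact ih _ hn

lemma TightlyNested.inner_unique {h k k' : Set V} (hk : TightlyNested T h k)
    (hk' : TightlyNested T h k') (hks : IsHalfspace T k) (hks' : IsHalfspace T k')
    (htot : k ⊆ k' ∨ k' ⊆ k) : k = k' := by
  by_contra hne
  rcases htot with hs | hs
  · exact hk.2 ⟨k', hks', hk'.1, hs.ssubset_of_ne hne⟩
  · exact hk'.2 ⟨k, hks, hk.1, hs.ssubset_of_ne (Ne.symm hne)⟩

lemma TightlyNested.outer_unique {h h' k : Set V} (hk : TightlyNested T h k)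
    (hk' : TightlyNested T h' k) (hs : IsHalfspace T h) (hs' : IsHalfspace T h')
    (htot : h ⊆ h' ∨ h' ⊆ h) : h = h' := by
  by_contra hne
  rcases htot with hsub | hsub
  · exact hk'.2 ⟨h, hs, hsub.ssubset_of_ne hne, hk.1⟩
  · exact hk.2 ⟨h', hs', hsub.ssubset_of_ne (Ne.symm hne), hk'.1⟩

lemma IsHSegment.eq_of_apply_eq (hT : T.IsTree) (ht : IsHSegment T l t) (ht' : IsHSegment T l t')
    {x y : V} (hs : SegIn T x y t) (hs' : SegIn T x y t') {i : Fin l} (hi : t i = t' i) :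
    t = t' := by
  have up : ∀ n : ℕ, ∀ hn : i + n < l, t ⟨i + n, hn⟩ = t' ⟨i + n, hn⟩ := by
    intro n
    induction n with
    | zero => exact fun _ => hi
    | succ n ih =>
      intro hn
      have h1 := ht.2 ⟨i + n, by omega⟩ ⟨i + (n + 1), hn⟩ rfl
      have h2 := ht'.2 ⟨i + n, by omega⟩ ⟨i + (n + 1), hn⟩ rfl
      rw [← ih (by omega)] at h2
      exact h1.inner_unique h2 (ht.1 _) (ht'.1 _) (sepH_total hT (hs _) (hs' _))
  have down : ∀ n : ℕ, ∀ k : Fin l, (k : ℕ) + n = i → t k = t' k := by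
    intro n
    induction n with
    | zero =>
      intro k hk
      obtain rfl : k = i := Fin.ext hk
      exact hi
    | succ n ih =>
      intro k hk
      have hkl : (k : ℕ) + 1 < l := by omega
      have h1 := ht.2 k ⟨k + 1, hkl⟩ rfl
      have h2 := ht'.2 k ⟨k + 1, hkl⟩ rfl
      rw [← ih ⟨k + 1, hkl⟩ (by simp only; omega)] at h2
      exact h1.outer_unique h2 (ht.1 _) (ht'.1 _) (sepH_total hT (hs _) (hs' _))
  funext k
  rcases le_total (i : ℕ) k with hik | hki
  · obtain ⟨n, hn⟩ := Nat.exists_eq_add_of_le hik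
    have hk : k = ⟨i + n, hn ▸ k.2⟩ := Fin.ext hn
    rw [hk]
    exact up n _
  · obtain ⟨n, hn⟩ := Nat.exists_eq_add_of_le hki
    exact down n k hn.symm

lemma IsHSegment.apply_eq_of_mem (hT : T.IsTree) (ht : IsHSegment T l t)
    (ht' : IsHSegment T l t') {x y z : V} (hs : SegIn T x y t) (hs' : SegIn T x y t')
    {i j : Fin l} (hij : (j : ℕ) = i + 1) (hi : z ∈ t i) (hj : z ∉ t j) (hi' : z ∈ t' i)
    (hj' : z ∉ t' j) : t i = t' i := by
  by_contra hne
  rcases sepH_total hT (hs i) (hs' i) with hsub | hsub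
  · refine (ht'.2 i j hij).2 ⟨t i, ht.1 i, hsub.ssubset_of_ne hne, ?_⟩
    rcases sepH_total hT (hs i) (hs' j) with h | h
    · exact absurd (h hi) hj'
    · exact ⟨h, fun h => hj' (h hi)⟩
  · refine (ht.2 i j hij).2 ⟨t' i, ht'.1 i, hsub.ssubset_of_ne (Ne.symm hne), ?_⟩
    rcases sepH_total hT (hs' i) (hs j) with h | h
    · exact absurd (h hi') hj
    · exact ⟨h, fun h => hj (h hi')⟩

/-- The segments in `[x,y]_H` that are cut by the vertex `z`. -/
def cutSegments (T : SimpleGraph V) (l : ℕ) (x y z : V) : Set (Fin l → Set V) :=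
  {t | IsHSegment T l t ∧ SegIn T x y t ∧ (∃ i, z ∈ t i) ∧ ∃ i, z ∉ t i}

lemma ncard_cutSegments_le (hT : T.IsTree) (hl : 1 ≤ l) (x y z : V) :
    (cutSegments T l x y z).ncard ≤ l := by
  have : Nonempty (Fin l) := ⟨⟨0, hl⟩⟩
  have hex : ∀ t ∈ cutSegments T l x y z,
      ∃ i j : Fin l, (j : ℕ) = i + 1 ∧ z ∈ t i ∧ z ∉ t j :=
    fun t ht => ht.1.exists_consecutive ht.2.2.1 ht.2.2.2
  choose! f g hg hf hgz using hex
  have hinj : Set.InjOn f (cutSegments T l x y z) := by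
    intro t ht t' ht' hff
    have hgg : g t = g t' := Fin.ext (by rw [hg t ht, hg t' ht', hff])
    exact ht.1.eq_of_apply_eq hT ht'.1 ht.2.1 ht'.2.1
      (ht.1.apply_eq_of_mem hT ht'.1 ht.2.1 ht'.2.1 (hg t ht) (hf t ht) (hgz t ht)
        (hff ▸ hf t' ht') (hgg ▸ hgz t' ht'))
  have := Set.ncard_le_ncard_of_injOn f (t := Set.univ) (fun _ _ => Set.mem_univ _) hinj
  simpa [Set.ncard_univ] using this

end Segments

section Action

variable {Γ : Type*} [Group Γ] [MulAction Γ V] {T : SimpleGraph V}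

lemma ActsOn.dist_smul_le (hact : ActsOn Γ T) (hT : T.IsTree) (γ : Γ) (u v : V) :
    T.dist (γ • u) (γ • v) ≤ T.dist u v := by
  obtain ⟨p, hp⟩ := hT.connected.exists_walk_length_eq_dist u v
  let f : T →g T := ⟨fun a => γ • a, fun {a b} h => hact γ a b h⟩
  have := T.dist_le (p.map f)
  rw [SimpleGraph.Walk.length_map, hp] at this
  exact this

lemma ActsOn.dist_smul (hact : ActsOn Γ T) (hT : T.IsTree) (γ : Γ) (u v : V) :
    T.dist (γ • u) (γ • v) = T.dist u v := by
  refine (hact.dist_smul_le hT γ u v).antisymm ?_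
  simpa using hact.dist_smul_le hT γ⁻¹ (γ • u) (γ • v)

open Pointwise in
lemma ActsOn.smul_side (hact : ActsOn Γ T) (hT : T.IsTree) (γ : Γ) (a b : V) :
    γ • side T a b = side T (γ • a) (γ • b) := by
  ext v
  rw [Set.mem_smul_set_iff_inv_smul_mem, Set.mem_ofPred_eq, Set.mem_ofPred_eq,
    ← hact.dist_smul hT γ, ← hact.dist_smul hT γ (γ⁻¹ • v) b, smul_inv_smul]

open Pointwise in
lemma IsHalfspace.smul (hact : ActsOn Γ T) (hT : T.IsTree) {h : Set V} (hh : IsHalfspace T h)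
    (γ : Γ) : IsHalfspace T (γ • h) := by
  obtain ⟨a, b, hab, rfl⟩ := hh
  exact ⟨γ • a, γ • b, hact γ a b hab, hact.smul_side hT γ a b⟩

open Pointwise in
lemma TightlyNested.smul (hact : ActsOn Γ T) (hT : T.IsTree) {h k : Set V}
    (hk : TightlyNested T h k) (γ : Γ) : TightlyNested T (γ • h) (γ • k) := by
  have hss : ∀ (γ : Γ) {A B : Set V}, A ⊂ B → γ • A ⊂ γ • B := fun γ A B hAB =>
    ⟨Set.smul_set_mono hAB.1, fun h => hAB.2 (Set.smul_set_subset_smul_set_iff.1 h)⟩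
  refine ⟨hss γ hk.1, ?_⟩
  rintro ⟨h', hh', h1, h2⟩
  refine hk.2 ⟨γ⁻¹ • h', hh'.smul hact hT _, ?_, ?_⟩
  · simpa using hss γ⁻¹ h1
  · simpa using hss γ⁻¹ h2

open Pointwise in
lemma IsHSegment.segSMul (hact : ActsOn Γ T) (hT : T.IsTree) {l : ℕ} {s : Fin l → Set V}
    (hs : IsHSegment T l s) (γ : Γ) : IsHSegment T l (segSMul γ s) :=
  ⟨fun i => (hs.1 i).smul hact hT γ, fun i j hij => (hs.2 i j hij).smul hact hT γ⟩

lemma segSMul_mul {l : ℕ} (s : Fin l → Set V) (γ γ' : Γ) :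
    segSMul (γ * γ') s = segSMul γ (segSMul γ' s) := by
  funext i
  simp only [segSMul, Set.image_image, mul_smul]

lemma segSMul_one {l : ℕ} (s : Fin l → Set V) : segSMul (1 : Γ) s = s := by
  funext i
  simp [segSMul]

open Pointwise in
lemma SegIn.segSMul (hact : ActsOn Γ T) (hT : T.IsTree) {l : ℕ} {t : Fin l → Set V} {x y : V}
    (h : SegIn T x y t) (γ : Γ) : SegIn T (γ • x) (γ • y) (segSMul γ t) := fun i =>
  ⟨(h i).1.smul hact hT γ, Set.smul_mem_smul_set (h i).2.1,
    fun hx => (h i).2.2 (Set.smul_mem_smul_set_iff.1 hx)⟩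

lemma segSMul_mem_translatesIn (hact : ActsOn Γ T) (hT : T.IsTree) {l : ℕ}
    {s t : Fin l → Set V} {x y : V} (h : t ∈ translatesIn T Γ s x y) (γ : Γ) :
    segSMul γ t ∈ translatesIn T Γ s (γ • x) (γ • y) := by
  obtain ⟨⟨γ', rfl⟩, h⟩ := h
  exact ⟨⟨γ * γ', (segSMul_mul s γ γ').symm⟩, h.segSMul hact hT γ⟩

lemma bijOn_segSMul_translatesIn (hact : ActsOn Γ T) (hT : T.IsTree) {l : ℕ}
    (s : Fin l → Set V) (x y : V) (γ : Γ) :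
    Set.BijOn (segSMul γ) (translatesIn T Γ s x y) (translatesIn T Γ s (γ • x) (γ • y)) := by
  refine ⟨fun t ht => segSMul_mem_translatesIn hact hT ht γ, fun t _ t' _ htt => ?_,
    fun t ht => ⟨segSMul γ⁻¹ t, ?_, ?_⟩⟩
  · simpa [← segSMul_mul, segSMul_one] using congrArg (segSMul γ⁻¹) htt
  · simpa using segSMul_mem_translatesIn hact hT ht γ⁻¹
  · rw [← segSMul_mul, mul_inv_cancel, segSMul_one]

lemma translatesIn_finite (hT : T.IsTree) {l : ℕ} (s : Fin l → Set V) (x y : V) :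
    (translatesIn T Γ s x y).Finite :=
  (Set.Finite.pi' fun _ : Fin l => sepH_finite hT x y).subset fun _ ht => ht.2

end Action

section WeightedSum

variable {Γ : Type*} [Group Γ] [MulAction Γ V] {T : SimpleGraph V} {l : ℕ}

/-- The signed sum of a weight `φ` over the translates of `s` between `x` and `y`. -/
noncomputable def weightedSum (T : SimpleGraph V) (Γ : Type*) [SMul Γ V] (s : Fin l → Set V)
    (φ : (Fin l → Set V) → ℝ) (x y : V) : ℝ :=
  (∑ᶠ t ∈ translatesIn T Γ s x y, φ t) - ∑ᶠ t ∈ translatesIn T Γ s y x, φ t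

lemma weightedSum_one (hT : T.IsTree) (s : Fin l → Set V) (x y : V) :
    weightedSum T Γ s (fun _ => 1) x y = fs T Γ s x y := by
  have h : ∀ x y : V, ∑ᶠ t ∈ translatesIn T Γ s x y, (1 : ℝ) =
      ((translatesIn T Γ s x y).ncard : ℝ) := fun x y => by
    rw [finsum_mem_eq_finite_toFinset_sum _ (translatesIn_finite hT s x y),
      Set.ncard_eq_toFinset_card _ (translatesIn_finite hT s x y)]
    simp
  rw [weightedSum, h, h, fs]

lemma weightedSum_combination (hT : T.IsTree) (s : Fin l → Set V)
    {φ₁ φ₂ φ₃ : (Fin l → Set V) → ℝ} {k : ℝ} (h : ∀ t, φ₁ t - φ₂ t + φ₃ t = k) (x y : V) :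
    weightedSum T Γ s φ₁ x y - weightedSum T Γ s φ₂ x y + weightedSum T Γ s φ₃ x y =
      fs T Γ s x y * k := by
  rw [← weightedSum_one hT]
  simp only [weightedSum, finsum_mem_eq_finite_toFinset_sum _ (translatesIn_finite hT s _ _)]
  have key : ∀ S : Finset (Fin l → Set V),
      ∑ t ∈ S, φ₁ t - ∑ t ∈ S, φ₂ t + ∑ t ∈ S, φ₃ t = (∑ t ∈ S, (1 : ℝ)) * k := fun S => by
    rw [← Finset.sum_sub_distrib, ← Finset.sum_add_distrib, Finset.sum_mul]
    exact Finset.sum_congr rfl fun t _ => by rw [h, one_mul]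
  linear_combination key (translatesIn_finite (Γ := Γ) hT s x y).toFinset -
    key (translatesIn_finite (Γ := Γ) hT s y x).toFinset

lemma weightedSum_smul (hact : ActsOn Γ T) (hT : T.IsTree) (s : Fin l → Set V)
    {φ φ' : (Fin l → Set V) → ℝ} (γ : Γ)
    (h : ∀ γ' : Γ, φ (segSMul γ' s) = φ' (segSMul γ (segSMul γ' s))) (x y : V) :
    weightedSum T Γ s φ' (γ • x) (γ • y) = weightedSum T Γ s φ x y := by
  have key : ∀ x y : V, ∑ᶠ t ∈ translatesIn T Γ s x y, φ t =
      ∑ᶠ t ∈ translatesIn T Γ s (γ • x) (γ • y), φ' t := fun x y =>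
    finsum_mem_eq_of_bijOn _ (bijOn_segSMul_translatesIn hact hT s x y γ) <| by
      rintro _ ⟨⟨γ', rfl⟩, -⟩
      exact h γ'
  rw [weightedSum, weightedSum, key, key]

lemma fs_smul (hact : ActsOn Γ T) (hT : T.IsTree) (s : Fin l → Set V) (γ : Γ) (x y : V) :
    fs T Γ s (γ • x) (γ • y) = fs T Γ s x y := by
  rw [← weightedSum_one hT, ← weightedSum_one hT]
  exact weightedSum_smul hact hT s γ (fun _ => rfl) x y

lemma abs_alternating_indicator_le (a₁ a₂ a₃ b₁ b₂ b₃ : Prop) [Decidable a₁] [Decidable a₂]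
    [Decidable a₃] [Decidable b₁] [Decidable b₂] [Decidable b₃] (h₁ : ¬(a₁ ∧ b₁))
    (h₂ : ¬(a₂ ∧ b₂)) (h₃ : ¬(a₃ ∧ b₃)) :
    |((if a₂ ∧ b₃ then (1 : ℝ) else 0) - (if a₃ ∧ b₂ then 1 else 0)) -
      ((if a₁ ∧ b₃ then 1 else 0) - (if a₃ ∧ b₁ then 1 else 0)) +
      ((if a₁ ∧ b₂ then 1 else 0) - (if a₂ ∧ b₁ then 1 else 0))| ≤
    (if a₂ ∧ b₃ ∧ ¬a₁ ∧ ¬b₁ then (1 : ℝ) else 0) + (if a₃ ∧ b₂ ∧ ¬a₁ ∧ ¬b₁ then 1 else 0) +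
      (if a₁ ∧ b₃ ∧ ¬a₂ ∧ ¬b₂ then 1 else 0) + (if a₃ ∧ b₁ ∧ ¬a₂ ∧ ¬b₂ then 1 else 0) +
      (if a₁ ∧ b₂ ∧ ¬a₃ ∧ ¬b₃ then 1 else 0) + (if a₂ ∧ b₁ ∧ ¬a₃ ∧ ¬b₃ then 1 else 0) := by
  by_cases a₁ <;> by_cases a₂ <;> by_cases a₃ <;> by_cases b₁ <;> by_cases b₂ <;>
    by_cases b₃ <;> simp_all

/-- The coboundary of a signed sum with bounded weight is bounded: only the translates cut by
one of the three vertices contribute. -/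
lemma abs_d1_weightedSum_le (hact : ActsOn Γ T) (hT : T.IsTree) (hl : 1 ≤ l)
    {s : Fin l → Set V} (hs : IsHSegment T l s) {φ : (Fin l → Set V) → ℝ} {B : ℝ}
    (hφ : ∀ t, |φ t| ≤ B) (x y z : V) :
    |d1 (weightedSum T Γ s φ) x y z| ≤ B * (6 * l) := by
  classical
  let P : V → V → Finset (Fin l → Set V) := fun x y =>
    (translatesIn_finite (Γ := Γ) hT s x y).toFinset
  let U := P y z ∪ P z y ∪ (P x z ∪ P z x) ∪ (P x y ∪ P y x)
  let A : V → (Fin l → Set V) → Prop := fun v t => ∀ i, v ∉ t i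
  let C : V → (Fin l → Set V) → Prop := fun v t => ∀ i, v ∈ t i
  have hU : ∀ t ∈ U, IsHSegment T l t ∧ ∃ γ : Γ, t = segSMul γ s := by
    intro t ht
    have : ∃ γ : Γ, t = segSMul γ s := by
      simp only [U, P, Finset.mem_union, Set.Finite.mem_toFinset, translatesIn,
        Set.mem_ofPred_eq] at ht
      tauto
    obtain ⟨γ, rfl⟩ := this
    exact ⟨hs.segSMul hact hT γ, γ, rfl⟩
  have hmem : ∀ t ∈ U, ∀ u v : V, t ∈ P u v ↔ A u t ∧ C v t := by
    intro t ht u v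
    obtain ⟨hseg, hγ⟩ := hU t ht
    simp only [P, Set.Finite.mem_toFinset, translatesIn, Set.mem_ofPred_eq, SegIn, sepH]
    exact ⟨fun h => ⟨fun i => (h.2 i).2.2, fun i => (h.2 i).2.1⟩,
      fun h => ⟨hγ, fun i => ⟨hseg.1 i, h.2 i, h.1 i⟩⟩⟩
  have hsum : ∀ u v : V, P u v ⊆ U → ∑ᶠ t ∈ translatesIn T Γ s u v, φ t =
      ∑ t ∈ U, φ t * if A u t ∧ C v t then 1 else 0 := by
    intro u v huv
    rw [finsum_mem_eq_finite_toFinset_sum _ (translatesIn_finite hT s u v)]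
    simp only [mul_ite, mul_one, mul_zero]
    rw [← Finset.sum_filter]
    refine Finset.sum_congr (Finset.ext fun t => ?_) fun _ _ => rfl
    rw [Finset.mem_filter]
    exact ⟨fun h => ⟨huv h, (hmem t (huv h) u v).1 h⟩, fun h => (hmem t h.1 u v).2 h.2⟩
  have hcut : ∀ u v w : V,
      ∑ t ∈ U, (if A u t ∧ C v t ∧ ¬A w t ∧ ¬C w t then (1 : ℝ) else 0) ≤ l := by
    intro u v w
    rw [Finset.sum_boole]
    refine Nat.cast_le.2 (le_trans ?_ (ncard_cutSegments_le hT hl u v w))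
    rw [← Set.ncard_coe_finset]
    refine Set.ncard_le_ncard ?_
      ((Set.Finite.pi' fun _ : Fin l => sepH_finite hT u v).subset fun _ ht => ht.2.1)
    intro t ht
    rw [Finset.mem_coe, Finset.mem_filter] at ht
    obtain ⟨htU, hu, hv, hw, hw'⟩ := ht
    refine ⟨(hU t htU).1, fun i => ⟨(hU t htU).1.1 i, hv i, hu i⟩, ?_, ?_⟩
    · simpa [A] using hw
    · simpa [C] using hw'
  have hexcl : ∀ v t, ¬(A v t ∧ C v t) := fun v t h => h.1 ⟨0, hl⟩ (h.2 ⟨0, hl⟩)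
  have hB : 0 ≤ B := (abs_nonneg _).trans (hφ s)
  rw [d1, weightedSum, weightedSum, weightedSum,
    hsum y z (by grind), hsum z y (by grind), hsum x z (by grind), hsum z x (by grind),
    hsum x y (by grind), hsum y x (by grind)]
  simp only [← Finset.sum_sub_distrib, ← Finset.sum_add_distrib, ← mul_sub, ← mul_add]
  calc _ ≤ ∑ t ∈ U, B * _ := (Finset.abs_sum_le_sum_abs _ _).trans <|
        Finset.sum_le_sum fun t _ => by
          rw [abs_mul]
          exact mul_le_mul (hφ t) (abs_alternating_indicator_le (A x t) (A y t) (A z t) (C x t)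
            (C y t) (C z t) (hexcl x t) (hexcl y t) (hexcl z t)) (abs_nonneg _) hB
    _ ≤ B * (6 * l) := by
      rw [← Finset.mul_sum]
      simp only [Finset.sum_add_distrib]
      refine mul_le_mul_of_nonneg_left ?_ hB
      linarith [hcut y z x, hcut z y x, hcut x z y, hcut z x y, hcut x y z, hcut y x z]

end WeightedSum

/-- An equivariant choice of a vertex for every halfspace of a tree. -/
lemma exists_anchor {T : SimpleGraph V} (hT : T.IsTree) [Nonempty V] :
    ∃ c : Set V → V, ∀ a b, T.Adj a b → c (side T a b) = a := by
  have : ∀ h : Set V, ∃ v : V, ∀ a b, T.Adj a b → side T a b = h → v = a := by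
    intro h
    by_cases hh : IsHalfspace T h
    · obtain ⟨a, b, hab, rfl⟩ := hh
      exact ⟨a, fun a' b' hab' h => (side_injective hT hab hab' h.symm).1⟩
    · exact ⟨Classical.arbitrary V, fun a b hab h => absurd ⟨a, b, hab, h.symm⟩ hh⟩
  choose c hc using this
  exact ⟨c, fun a b hab => hc _ a b hab rfl⟩

/-- Corollary `cor:maintreegroup`, case of two median classes: for a
group acting on a tree `T`, H-segments `s`, `r` and base vertices `x`, `w`, the cup
product `(δ¹f̂_{s,x}) ∪ (δ¹f̂_{r,w})` has a bounded Γ-invariant primitive on `Γ`;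
i.e. `[δ¹f̂_{s,x}] ∪ [δ¹f̂_{r,w}] = 0` in degree-4 bounded cohomology of `Γ`. -/
theorem statement6 {V : Type*} (T : SimpleGraph V) (hT : T.IsTree)
    (Γ : Type*) [Group Γ] [MulAction Γ V] (hact : ActsOn Γ T)
    (l p : ℕ) (hl : 1 ≤ l) (hp : 1 ≤ p)
    (s : Fin l → Set V) (hseg : IsHSegment T l s)
    (r : Fin p → Set V) (hrseg : IsHSegment T p r)
    (x w : V) :
    ∃ β : (Fin 4 → Γ) → ℝ, IsBounded β ∧ IsInvariant Γ β ∧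
      ∀ g : Fin 5 → Γ,
        cob β g =
          d1 (fun γ₀ γ₁ : Γ => fs T Γ s (γ₀ • x) (γ₁ • x)) (g 0) (g 1) (g 2) *
            d1 (fun γ₀ γ₁ : Γ => fs T Γ r (γ₀ • w) (γ₁ • w)) (g 2) (g 3) (g 4) := by
  obtain ⟨c, hc⟩ := (have : Nonempty V := ⟨x⟩; exists_anchor hT)
  have hc_smul : ∀ (γ : Γ) (h : Set V), IsHalfspace T h → c ((γ • ·) '' h) = γ • c h := by
    rintro γ _ ⟨a, b, hab, rfl⟩
    exact (congrArg c (hact.smul_side hT γ a b)).trans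
      ((hc _ _ (hact γ a b hab)).trans (congrArg _ (hc a b hab).symm))
  let κ : V → V → V → ℝ := d1 (fs T Γ r)
  have hκ : ∀ u v w : V, |κ u v w| ≤ 6 * p := by
    intro u v w
    have h1 : fs T Γ r = weightedSum T Γ r fun _ => 1 := by
      funext u v
      exact (weightedSum_one hT r u v).symm
    have := abs_d1_weightedSum_le (Γ := Γ) hact hT hp hrseg (φ := fun _ => 1) (B := 1)
      (fun _ => by simp) u v w
    rw [← h1, one_mul] at this
    exact this
  have hκ_smul : ∀ (γ : Γ) (u v w : V), κ (γ • u) (γ • v) (γ • w) = κ u v w := by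
    intro γ u v w
    simp only [κ, d1, fs_smul hact hT]
  let φ : Γ → Γ → (Fin l → Set V) → ℝ := fun γ γ' t => κ (c (t ⟨0, hl⟩)) (γ • w) (γ' • w)
  have hφ_smul : ∀ (γ γ₂ γ₃ : Γ) (u v : V),
      weightedSum T Γ s (φ (γ * γ₂) (γ * γ₃)) (γ • u) (γ • v) =
        weightedSum T Γ s (φ γ₂ γ₃) u v := by
    intro γ γ₂ γ₃ u v
    refine weightedSum_smul hact hT s γ (fun γ' => ?_) u v
    have : c (segSMul γ (segSMul γ' s) ⟨0, hl⟩) = γ • c (segSMul γ' s ⟨0, hl⟩) :=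
      hc_smul γ _ ((hseg.segSMul hact hT γ').1 _)
    simp only [φ, this, mul_smul, hκ_smul]
  refine ⟨fun g => d1 (weightedSum T Γ s (φ (g 2) (g 3))) (g 0 • x) (g 1 • x) (g 2 • x),
    ⟨6 * p * (6 * l), fun g => abs_d1_weightedSum_le hact hT hl hseg (fun t => hκ _ _ _) _ _ _⟩,
    fun γ g => ?_, fun g => ?_⟩
  · simp only [d1, smul_eq_mul, mul_smul, hφ_smul]
  · have hcomb := fun u v : V => weightedSum_combination (Γ := Γ) hT s
      (φ₁ := φ (g 3) (g 4)) (φ₂ := φ (g 2) (g 4)) (φ₃ := φ (g 2) (g 3))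
      (k := κ (g 2 • w) (g 3 • w) (g 4 • w)) (fun t => by simp only [φ, κ, d1]; ring) u v
    have h01 := hcomb (g 0 • x) (g 1 • x)
    have h12 := hcomb (g 1 • x) (g 2 • x)
    have h02 := hcomb (g 0 • x) (g 2 • x)
    change _ = d1 (fs T Γ s) (g 0 • x) (g 1 • x) (g 2 • x) * κ (g 2 • w) (g 3 • w) (g 4 • w)
    refine (Fin.sum_univ_five _).trans ?_
    simp [Fin.succAbove]
    simp only [d1]
    linear_combination h01 + h12 - h02

end MedianQM
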